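/- arXiv:2412.16862 — 2 statements merged into one kernel-verified Lean document; each statement's English description precedes it below -/
import Mathlib

section
/- Let 0 ≤ c ≤ a ≤ 1/2 and set w = (1−a, 1−c) ∈ ℝ². Then the distance from w to each of the six points q_UL = (−1+c, 2+a), q_L = (−1−a, c), q_LD = (−1−c, −a), q_UR = (2−c, 3−a), q_R = (3−a, c), q_RD = (2+c, −1+a) is at least the distance from w to q_U = (a, 3−c) (which equals the distance from w to q_D = (a, −1−c)). Consequently the circle centered at w passing through q_U and q_D contains none of the other six points in its interior. -/
/-- The point (x, y) of the Euclidean plane. -/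
noncomputable def pt2 (x y : ℝ) : EuclideanSpace ℝ (Fin 2) :=
  (WithLp.equiv 2 (Fin 2 → ℝ)).symm ![x, y]

theorem dist_pt2 (x y x' y' : ℝ) :
    dist (pt2 x y) (pt2 x' y') = √((x - x') ^ 2 + (y - y') ^ 2) := by
  simp [pt2, EuclideanSpace.dist_eq, Real.dist_eq, sq_abs]

/-- Empty-circle property of the segment [q_U, q_D]: the circle centered at
w = (1−a, 1−c) through q_U = (a, 3−c) and q_D = (a, −1−c) contains none of the
other six projected source images in its interior. -/
theorem UD_Delaunay_edge (a c : ℝ) (hc : 0 ≤ c) (hca : c ≤ a) (ha : a ≤ 1 / 2) :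
    dist (pt2 (1 - a) (1 - c)) (pt2 a (3 - c)) =
        dist (pt2 (1 - a) (1 - c)) (pt2 a (-1 - c)) ∧
      dist (pt2 (1 - a) (1 - c)) (pt2 a (3 - c)) ≤
        dist (pt2 (1 - a) (1 - c)) (pt2 (-1 + c) (2 + a)) ∧
      dist (pt2 (1 - a) (1 - c)) (pt2 a (3 - c)) ≤
        dist (pt2 (1 - a) (1 - c)) (pt2 (-1 - a) c) ∧
      dist (pt2 (1 - a) (1 - c)) (pt2 a (3 - c)) ≤
        dist (pt2 (1 - a) (1 - c)) (pt2 (-1 - c) (-a)) ∧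
      dist (pt2 (1 - a) (1 - c)) (pt2 a (3 - c)) ≤
        dist (pt2 (1 - a) (1 - c)) (pt2 (2 - c) (3 - a)) ∧
      dist (pt2 (1 - a) (1 - c)) (pt2 a (3 - c)) ≤
        dist (pt2 (1 - a) (1 - c)) (pt2 (3 - a) c) ∧
      dist (pt2 (1 - a) (1 - c)) (pt2 a (3 - c)) ≤
        dist (pt2 (1 - a) (1 - c)) (pt2 (2 + c) (-1 + a)) := by
  have hc' : c ≤ 1 / 2 := hca.trans ha
  have h₁ : 0 ≤ (a - c) * (1 - a - c) := mul_nonneg (by linarith) (by linarith)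
  have h₂ : 0 ≤ a * c := mul_nonneg (hc.trans hca) hc
  have h₃ : 0 ≤ a * (1 - a) := mul_nonneg (hc.trans hca) (by linarith)
  have h₄ : 0 ≤ c * (1 - 2 * a) := mul_nonneg hc (by linarith)
  simp only [dist_pt2]
  refine ⟨by ring_nf, ?_, ?_, ?_, ?_, ?_, ?_⟩ <;>
    refine Real.sqrt_le_sqrt ?_ <;> nlinarith [sq_nonneg c]
end

section
/- For all real a, b, c with 0 ≤ c ≤ b ≤ a ≤ 1/2, the point w = (1 − (a+c)(1−c)/(2−a+c), 1 − (b+c)(1−c)/(2−b+c), 1−c) in ℝ³ is equidistant from the four points p_U = (a, b, 3−c), p_BD = (a, 2+c, −1+b), p_D = (a, b, −1−c), p_RD = (2+c, b, −1+a). -/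
/-- The point (x, y, z) of Euclidean 3-space. -/
noncomputable def pt3 (x y z : ℝ) : EuclideanSpace ℝ (Fin 3) :=
  (WithLp.equiv 2 (Fin 3 → ℝ)).symm ![x, y, z]

/-- A point `w` is equidistant from four points. -/
def Equidist4 (w p q r s : EuclideanSpace ℝ (Fin 3)) : Prop :=
  dist w p = dist w q ∧ dist w q = dist w r ∧ dist w r = dist w s

theorem dist_pt3 (x y z x' y' z' : ℝ) :
    dist (pt3 x y z) (pt3 x' y' z') =
      Real.sqrt ((x - x') ^ 2 + (y - y') ^ 2 + (z - z') ^ 2) := by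
  simp [pt3, EuclideanSpace.dist_eq, Fin.sum_univ_three, Real.dist_eq, sq_abs]

/-- The planar equidistance identity behind both nontrivial distance comparisons. -/
theorem sq_add_sq_equidist {t c : ℝ} (h : 2 - t + c ≠ 0) :
    (1 - (t + c) * (1 - c) / (2 - t + c) - (2 + c)) ^ 2 + (1 - c - (-1 + t)) ^ 2 =
      (1 - (t + c) * (1 - c) / (2 - t + c) - t) ^ 2 + (1 - c - (-1 - c)) ^ 2 := by
  field_simp
  ring

/-- The circumcenter c(BD,D,RD) of the tetrahedron (p_U, p_BD, p_D, p_RD). -/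
theorem circumcenter_BD_D_RD (a b c : ℝ) (hc : 0 ≤ c) (hcb : c ≤ b) (hba : b ≤ a)
    (ha : a ≤ 1 / 2) :
    Equidist4
      (pt3 (1 - (a + c) * (1 - c) / (2 - a + c))
        (1 - (b + c) * (1 - c) / (2 - b + c)) (1 - c))
      (pt3 a b (3 - c)) (pt3 a (2 + c) (-1 + b)) (pt3 a b (-1 - c))
      (pt3 (2 + c) b (-1 + a)) := by
  have hA := sq_add_sq_equidist (t := a) (c := c) (by linarith)
  have hB := sq_add_sq_equidist (t := b) (c := c) (by linarith)
  simp only [Equidist4, dist_pt3]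
  refine ⟨?_, ?_, ?_⟩ <;> congr 1 <;> linarith
end
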